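/- For every rotation matrix R ∈ SO(3), the symmetric 4×4 matrix M(R) (with entries built from the entries r_ij of R as: first row [1 + r₁₁ + r₂₂ + r₃₃, r₃₂ − r₂₃, r₁₃ − r₃₁, r₂₁ − r₁₂], second row [r₃₂ − r₂₃, 1 + r₁₁ − r₂₂ − r₃₃, r₂₁ + r₁₂, r₁₃ + r₃₁], third row [r₁₃ − r₃₁, r₂₁ + r₁₂, 1 − r₁₁ + r₂₂ − r₃₃, r₃₂ + r₂₃], fourth row [r₂₁ − r₁₂, r₁₃ + r₃₁, r₃₂ + r₂₃, 1 − r₁₁ − r₂₂ + r₃₃]) is positive semidefinite. -/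

import Mathlib

/-- SO(3): the set of 3×3 real matrices `R` with `R * Rᵀ = 1` and `det R = 1`. -/
def SO3 : Set (Matrix (Fin 3) (Fin 3) ℝ) :=
  {R | R * R.transpose = 1 ∧ R.det = 1}

/-- The symmetric 4×4 matrix `M(X)` associated to a 3×3 matrix `X`. -/
def MX (X : Matrix (Fin 3) (Fin 3) ℝ) : Matrix (Fin 4) (Fin 4) ℝ :=
  !![1 + X 0 0 + X 1 1 + X 2 2, X 2 1 - X 1 2, X 0 2 - X 2 0, X 1 0 - X 0 1;
     X 2 1 - X 1 2, 1 + X 0 0 - X 1 1 - X 2 2, X 1 0 + X 0 1, X 0 2 + X 2 0;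
     X 0 2 - X 2 0, X 1 0 + X 0 1, 1 - X 0 0 + X 1 1 - X 2 2, X 2 1 + X 1 2;
     X 1 0 - X 0 1, X 0 2 + X 2 0, X 2 1 + X 1 2, 1 - X 0 0 - X 1 1 + X 2 2]

/-- A rotation matrix is its own cofactor matrix. -/
theorem adjugate_eq_transpose_of_mem_SO3 {R : Matrix (Fin 3) (Fin 3) ℝ} (hR : R ∈ SO3) :
    R.adjugate = R.transpose := by
  calc R.adjugate = R.adjugate * (R * R.transpose) := by rw [hR.1, mul_one]
    _ = R.transpose := by rw [← mul_assoc, Matrix.adjugate_mul, hR.2, one_smul, one_mul]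

theorem MX_transpose (X : Matrix (Fin 3) (Fin 3) ℝ) : (MX X).transpose = MX X := by
  ext i j
  fin_cases i <;> fin_cases j <;> simp [MX]

set_option maxHeartbeats 1000000 in
/-- For a rotation matrix `R`, the matrix `M(R) / 4` is idempotent. -/
theorem MX_mul_self_of_mem_SO3 {R : Matrix (Fin 3) (Fin 3) ℝ} (hR : R ∈ SO3) :
    MX R * MX R = (4 : ℝ) • MX R := by
  have row (i j) := congrFun (congrFun hR.1 i) j
  have hcol : R.transpose * R = 1 := mul_eq_one_comm.mp hR.1
  have col (i j) := congrFun (congrFun hcol i) j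
  have cof (i j) := congrFun (congrFun (adjugate_eq_transpose_of_mem_SO3 hR) i) j
  simp only [Matrix.adjugate_fin_three, Fin.forall_fin_succ, Matrix.mul_apply,
    Matrix.transpose_apply, Fin.sum_univ_three] at row col cof
  simp [Matrix.one_apply] at row col cof
  obtain ⟨⟨a1, a2, a3⟩, ⟨a4, a5, a6⟩, a7, a8, a9⟩ := row
  obtain ⟨⟨b1, b2, b3⟩, ⟨b4, b5, b6⟩, b7, b8, b9⟩ := col
  obtain ⟨⟨c1, c2, c3⟩, ⟨c4, c5, c6⟩, c7, c8, c9⟩ := cof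
  ext i j
  fin_cases i <;> fin_cases j <;>
    simp [MX, Matrix.mul_apply, Fin.sum_univ_four] <;> linarith

theorem posSemidef_MX_of_mem_SO3 (R : Matrix (Fin 3) (Fin 3) ℝ) (hR : R ∈ SO3) :
    (MX R).PosSemidef := by
  have h : MX R = (4 : ℝ)⁻¹ • (MX R * (MX R).conjTranspose) := by
    rw [Matrix.conjTranspose_eq_transpose_of_trivial, MX_transpose, MX_mul_self_of_mem_SO3 hR,
      smul_smul]
    norm_num
  rw [h]
  exact (Matrix.posSemidef_self_mul_conjTranspose (MX R)).smul (by norm_num)
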